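/- Let D = Z_3 × Z_{3^n} with n ≥ 2, A an S-ring over D, C₁ the unique subgroup of order 3 contained in the cyclic factor Z_{3^n}, and T a nonregular basic set of A (i.e., T contains elements of at least two distinct orders). If C₁ is an A-subgroup, then C₁ ≤ rad(T), i.e., c₁T = T for the generator c₁ of C₁. -/

import Mathlib

open scoped BigOperators Pointwise Classical

noncomputable section

/-- The group-ring element `X̄ = Σ_{x∈X} x` in `ℤG`. -/
def ind {G : Type*} [Group G] (X : Finset G) : MonoidAlgebra ℤ G :=
  ∑ x ∈ X, MonoidAlgebra.single x 1

/-- The ℤ-span of the class sums of the members of `S`. -/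
def spanA {G : Type*} [Group G] (S : Finset (Finset G)) :
    Submodule ℤ (MonoidAlgebra ℤ G) :=
  Submodule.span ℤ (ind '' (S : Set (Finset G)))

/-- `S` is the partition of basic sets of an S-ring over `G`. -/
structure IsSRing {G : Type*} [Group G] (S : Finset (Finset G)) : Prop where
  cover : ∀ g : G, ∃ X ∈ S, g ∈ X
  disj : ∀ X ∈ S, ∀ Y ∈ S, X ≠ Y → Disjoint X Y
  nonempty : ∀ X ∈ S, X.Nonempty
  one_mem : ({1} : Finset G) ∈ S
  inv_mem : ∀ X ∈ S, X.image (·⁻¹) ∈ S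
  mul_closed : ∀ a ∈ spanA S, ∀ b ∈ spanA S, a * b ∈ spanA S

/-- `X` is an `A`-set: its class sum lies in the span of the basic class sums. -/
def IsASet {G : Type*} [Group G] (S : Finset (Finset G)) (X : Finset G) : Prop :=
  ind X ∈ spanA S

/-- The finset underlying a subgroup of a finite group. -/
def subgroupFinset {G : Type*} [Group G] [Fintype G] (H : Subgroup G) : Finset G :=
  Finset.univ.filter (· ∈ H)

/-- `H` is an `A`-subgroup. -/
def IsASubgroup {G : Type*} [Group G] [Fintype G] (S : Finset (Finset G))
    (H : Subgroup G) : Prop :=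
  IsASet S (subgroupFinset H)

/-- The radical `rad(X) = {g : gX = Xg = X}` as a subgroup. -/
def radSubgroup {G : Type*} [Group G] (X : Finset G) : Subgroup G where
  carrier := {g : G | X.image (g * ·) = X ∧ X.image (· * g) = X}
  one_mem' := by
    constructor <;> · simp only [one_mul, mul_one]; exact Finset.image_id
  mul_mem' := by
    rintro a b ⟨ha1, ha2⟩ ⟨hb1, hb2⟩
    constructor
    · have : X.image (a * b * ·) = (X.image (b * ·)).image (a * ·) := by
        rw [Finset.image_image]
        exact Finset.image_congr (fun x _ => by simp [mul_assoc])
      rw [this, hb1, ha1]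
    · have : X.image (· * (a * b)) = (X.image (· * a)).image (· * b) := by
        rw [Finset.image_image]
        exact Finset.image_congr (fun x _ => by simp [mul_assoc])
      rw [this, ha2, hb2]
  inv_mem' := by
    rintro a ⟨ha1, ha2⟩
    constructor
    · have := congrArg (Finset.image (a⁻¹ * ·)) ha1
      rw [Finset.image_image] at this
      have h2 : X.image ((a⁻¹ * ·) ∘ (a * ·)) = X := by
        rw [show ((a⁻¹ * ·) ∘ (a * ·)) = id by funext x; simp, Finset.image_id]
      rw [← this, h2]
    · have := congrArg (Finset.image (· * a⁻¹)) ha2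
      rw [Finset.image_image] at this
      have h2 : X.image ((· * a⁻¹) ∘ (· * a)) = X := by
        rw [show ((· * a⁻¹) ∘ (· * a)) = id by funext x; simp, Finset.image_id]
      rw [← this, h2]

end

instance nePow (a k : ℕ) [NeZero a] : NeZero (a ^ k) := ⟨pow_ne_zero k (NeZero.ne a)⟩

/-- The group `D = ℤ₃ × ℤ_{3^n}` (written multiplicatively). -/
abbrev Dgrp (n : ℕ) := Multiplicative (ZMod 3) × Multiplicative (ZMod (3 ^ n))


/-- The finset `X` is a union of basic sets. -/
def SClosed {G : Type*} (S : Finset (Finset G)) (X : Finset G) : Prop :=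
  ∀ Y ∈ S, ∀ y ∈ Y, y ∈ X → Y ⊆ X

theorem ind_coeff {G : Type*} [Group G] (X : Finset G) (g : G) :
    (ind X).coeff g = if g ∈ X then 1 else 0 := by
  simp [ind, MonoidAlgebra.coeff_sum, Finsupp.finsetSum_apply, Finsupp.single_apply]

theorem spanA_const {G : Type*} [Group G] {S : Finset (Finset G)} (hS : IsSRing S)
    {a : MonoidAlgebra ℤ G} (ha : a ∈ spanA S) {Y : Finset G} (hY : Y ∈ S)
    {x y : G} (hx : x ∈ Y) (hy : y ∈ Y) : a.coeff x = a.coeff y := by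
  unfold spanA at ha
  induction ha using Submodule.span_induction with
  | mem a h =>
    obtain ⟨X, hX, rfl⟩ := h
    rw [ind_coeff, ind_coeff]
    by_cases hXY : X = Y
    · subst hXY; simp [hx, hy]
    · have hd := hS.disj X hX Y hY hXY
      have h1 : x ∉ X := fun h => Finset.disjoint_left.mp hd h hx
      have h2 : y ∉ X := fun h => Finset.disjoint_left.mp hd h hy
      simp [h1, h2]
  | zero => simp
  | add a b _ _ iha ihb => simp [iha, ihb]
  | smul r a _ iha => rw [MonoidAlgebra.coeff_smul, Finsupp.smul_apply, Finsupp.smul_apply, iha]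

theorem ind_mem_of_closed {G : Type*} [Group G] {S : Finset (Finset G)} (hS : IsSRing S)
    {X : Finset G} (hX : SClosed S X) : ind X ∈ spanA S := by
  have hXu : X = (S.filter (· ⊆ X)).biUnion id := by
    ext g
    simp only [Finset.mem_biUnion, Finset.mem_filter, id]
    constructor
    · intro hg
      obtain ⟨Y, hY, hgY⟩ := hS.cover g
      exact ⟨Y, ⟨hY, hX Y hY g hgY hg⟩, hgY⟩
    · rintro ⟨Y, ⟨_, h⟩, hg⟩
      exact h hg
  have : ind X = ∑ Y ∈ S.filter (· ⊆ X), ind Y := by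
    conv_lhs => rw [hXu]
    unfold ind
    rw [Finset.sum_biUnion]
    · rfl
    · intro Y hY Z hZ hne
      simp only [Finset.coe_filter, Set.mem_ofPred_eq] at hY hZ
      exact hS.disj Y hY.1 Z hZ.1 hne
  rw [this]
  refine Submodule.sum_mem _ fun Y hY => Submodule.subset_span ⟨Y, ?_, rfl⟩
  exact (Finset.mem_filter.mp hY).1

theorem pow_mem_spanA {G : Type*} [Group G] {S : Finset (Finset G)} (hS : IsSRing S)
    {a : MonoidAlgebra ℤ G} (ha : a ∈ spanA S) (k : ℕ) : a ^ (k + 1) ∈ spanA S := by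
  induction k with
  | zero => simpa using ha
  | succ k ih => rw [pow_succ]; exact hS.mul_closed _ ih _ ha

theorem closed_pow_prime {G : Type*} [CommGroup G] [Finite G] {S : Finset (Finset G)}
    (hS : IsSRing S) {X : Finset G} (hX : SClosed S X) {p : ℕ} (hp : p.Prime)
    (hcop : (Nat.card G).Coprime p) : SClosed S (X.image (· ^ p)) := by
  haveI := Fact.mk hp
  have hinj : Function.Injective (fun x : G => x ^ p) := (powCoprime hcop).injective
  have hpow : ind X ^ p ∈ spanA S := by
    obtain ⟨k, rfl⟩ : ∃ k, p = k + 1 := ⟨p - 1, by have := hp.pos; omega⟩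
    exact pow_mem_spanA hS (ind_mem_of_closed hS hX) k
  have key : ∀ g : G, (((ind X ^ p).coeff g : ℤ) : ZMod p)
      = if g ∈ X.image (· ^ p) then 1 else 0 := by
    intro g
    have h1 : MonoidAlgebra.mapRingHom G (Int.castRingHom (ZMod p)) (ind X ^ p)
        = ∑ x ∈ X, MonoidAlgebra.single (x ^ p) 1 := by
      haveI : CharP (MonoidAlgebra (ZMod p) G) p :=
        charP_of_injective_algebraMap
          (FaithfulSMul.algebraMap_injective (ZMod p) (MonoidAlgebra (ZMod p) G)) p
      rw [map_pow, ind, map_sum, sum_pow_char]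
      refine Finset.sum_congr rfl fun x _ => ?_
      simp [MonoidAlgebra.single_pow]
    have h2 := congrArg (fun f => f.coeff g) h1
    have h3 : (MonoidAlgebra.mapRingHom G (Int.castRingHom (ZMod p)) (ind X ^ p)).coeff g
        = (((ind X ^ p).coeff g : ℤ) : ZMod p) := by
      generalize ind X ^ p = f
      simp
    simp only [h3] at h2
    rw [← Finset.sum_image (g := fun x : G => x ^ p)
      (f := fun y => (MonoidAlgebra.single y 1 : MonoidAlgebra (ZMod p) G)) hinj.injOn] at h2
    simpa [MonoidAlgebra.coeff_sum, Finsupp.finsetSum_apply, Finsupp.single_apply] using h2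
  intro Y hY y hy hyX z hz
  have h := spanA_const hS hpow hY hy hz
  have k1 := key y
  have k2 := key z
  rw [if_pos hyX, h, k2] at k1
  by_contra hc
  rw [if_neg hc] at k1
  exact zero_ne_one k1

theorem closed_pow {G : Type*} [CommGroup G] [Finite G] {S : Finset (Finset G)}
    (hS : IsSRing S) (m : ℕ) : m ≠ 0 → (Nat.card G).Coprime m →
    ∀ X : Finset G, SClosed S X → SClosed S (X.image (· ^ m)) := by
  induction m using induction_on_primes with
  | zero => intro h; exact absurd rfl h
  | one => intro _ _ X hX; simpa using hX
  | prime_mul p a hp ih =>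
    intro h0 hc X hX
    have ha := ih (by rintro rfl; simp at h0) (Nat.Coprime.coprime_mul_left_right hc) X hX
    have hb := closed_pow_prime hS ha hp (Nat.Coprime.coprime_mul_right_right hc)
    rw [Finset.image_image] at hb
    convert hb using 2
    funext x
    simp [mul_comm p a, pow_mul]

theorem basic_closed {G : Type*} [Group G] {S : Finset (Finset G)} (hS : IsSRing S)
    {T : Finset G} (hT : T ∈ S) : SClosed S T := by
  intro Y hY y hy hyT
  by_cases h : Y = T
  · exact h.subset
  · exact absurd hyT (Finset.disjoint_left.mp (hS.disj Y hY T hT h) hy)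

theorem basic_pow {G : Type*} [CommGroup G] [Finite G] {S : Finset (Finset G)}
    (hS : IsSRing S) {T : Finset G} (hT : T ∈ S) {m : ℕ} (hm : m ≠ 0)
    (hc : (Nat.card G).Coprime m) {y : G} (hy : y ∈ T) (hym : y ^ m = y)
    {x : G} (hx : x ∈ T) : x ^ m ∈ T := by
  have h := closed_pow hS m hm hc T (basic_closed hS hT) T hT y hy
    (Finset.mem_image.mpr ⟨y, hy, hym⟩)
  have := Finset.eq_of_subset_of_card_le h Finset.card_image_le
  rw [this]
  exact Finset.mem_image_of_mem _ hx

theorem coset_all {G : Type*} [CommGroup G] [Fintype G] {S : Finset (Finset G)}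
    (hS : IsSRing S) {T : Finset G} (hT : T ∈ S) {H : Subgroup G} (hH : IsASubgroup S H)
    {x : G} (hx : x ∈ T) (hxH : ∀ h ∈ H, x * h ∈ T) {y : G} (hy : y ∈ T) :
    ∀ h ∈ H, y * h ∈ T := by
  have hprod := hS.mul_closed _ (Submodule.subset_span ⟨T, hT, rfl⟩ : ind T ∈ spanA S) _ hH
  have hco : ∀ g : G, (ind T * ind (subgroupFinset H)).coeff g
      = ∑ h ∈ subgroupFinset H, if g * h⁻¹ ∈ T then (1 : ℤ) else 0 := by
    intro g
    conv_lhs => rw [ind.eq_def (subgroupFinset H)]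
    simp [Finset.mul_sum, MonoidAlgebra.coeff_sum, Finsupp.finsetSum_apply, ind_coeff]
  have he := spanA_const hS hprod hT hx hy
  rw [hco, hco] at he
  have hle : ∀ h ∈ subgroupFinset H, (if y * h⁻¹ ∈ T then (1 : ℤ) else 0)
      ≤ if x * h⁻¹ ∈ T then (1 : ℤ) else 0 := by
    intro h hh
    rw [if_pos (hxH _ (H.inv_mem (by simpa [subgroupFinset] using hh)))]
    split_ifs <;> norm_num
  have hall := (Finset.sum_eq_sum_iff_of_le hle).mp he.symm
  intro h hh
  have h1 := hall h⁻¹ (by simpa [subgroupFinset] using hh)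
  rw [inv_inv, if_pos (hxH h hh)] at h1
  by_contra hc
  simp [hc] at h1

theorem mem_zpowers_of_cyclic {G : Type*} [CommGroup G] [Finite G] [IsCyclic G] {a b : G}
    (h : orderOf a = orderOf b) : a ∈ Subgroup.zpowers b := by
  haveI := Fintype.ofFinite G
  have hpos : 0 < orderOf b := orderOf_pos b
  have hle := IsCyclic.card_pow_eq_one_le (α := G) hpos
  have hsub : subgroupFinset (Subgroup.zpowers b)
      ⊆ Finset.univ.filter (fun g : G => g ^ orderOf b = 1) := by
    intro g hg
    simp only [subgroupFinset, Finset.mem_filter, Finset.mem_univ, true_and] at hg ⊢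
    exact orderOf_dvd_iff_pow_eq_one.mp (orderOf_dvd_of_mem_zpowers hg)
  have hcard : (subgroupFinset (Subgroup.zpowers b)).card = orderOf b := by
    rw [← Nat.card_zpowers, subgroupFinset, ← Nat.subtype_card]
    simp
  have heq := Finset.eq_of_subset_of_card_le hsub (by rw [hcard]; convert hle)
  have : a ∈ subgroupFinset (Subgroup.zpowers b) := by
    rw [heq]; simp [← h, pow_orderOf_eq_one]
  simpa [subgroupFinset] using this

/-- if `C₁` (the subgroup of order 3 of the cyclic factor)
is an `A`-subgroup and `T` is a nonregular basic set, then `C₁ ≤ rad(T)`,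
i.e. `c₁T = T`. -/
theorem stmt11 (n : ℕ) (hn : 2 ≤ n) (S : Finset (Finset (Dgrp n)))
    (hS : IsSRing S) (c₁ : Multiplicative (ZMod (3 ^ n))) (hc₁ : orderOf c₁ = 3)
    (hC1 : IsASubgroup S (Subgroup.zpowers ((1, c₁) : Dgrp n)))
    (T : Finset (Dgrp n)) (hT : T ∈ S)
    (hnonreg : ∃ a ∈ T, ∃ b ∈ T, orderOf a ≠ orderOf b) :
    T.image (((1, c₁) : Dgrp n) * ·) = T := by
  have hD3 : ∀ g : Dgrp n, g ^ 3 ^ n = 1 := by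
    rintro ⟨s, c⟩
    have hs : s ^ 3 = 1 := by
      simpa using pow_card_eq_one' (x := s)
    have hc : c ^ 3 ^ n = 1 := by
      simpa using pow_card_eq_one' (x := c)
    obtain ⟨k, rfl⟩ : ∃ k, n = k + 1 := ⟨n - 1, by omega⟩
    refine Prod.ext ?_ hc
    change s ^ 3 ^ (k + 1) = 1
    rw [pow_succ', pow_mul, hs, one_pow]
  obtain ⟨x, hx, y, hy, hlt⟩ : ∃ x ∈ T, ∃ y ∈ T, orderOf y < orderOf x := by
    obtain ⟨a, ha, b, hb, hab⟩ := hnonreg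
    rcases lt_or_gt_of_ne hab with h | h
    · exact ⟨b, hb, a, ha, h⟩
    · exact ⟨a, ha, b, hb, h⟩
  have hy1 : y ≠ 1 := by
    rintro rfl
    have : T ⊆ {1} := basic_closed hS hS.one_mem T hT 1 hy (by simp)
    have hx1 := Finset.mem_singleton.mp (this hx)
    rw [hx1] at hlt
    exact lt_irrefl _ hlt
  obtain ⟨k, -, hk⟩ := (Nat.dvd_prime_pow Nat.prime_three).mp (orderOf_dvd_of_pow_eq_one (hD3 x))
  obtain ⟨j, -, hj⟩ := (Nat.dvd_prime_pow Nat.prime_three).mp (orderOf_dvd_of_pow_eq_one (hD3 y))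
  have hj0 : j ≠ 0 := by
    rintro rfl
    exact hy1 (orderOf_eq_one_iff.mp (by simpa using hj))
  have hjk : j < k := by
    rw [hk, hj] at hlt
    exact (Nat.pow_lt_pow_iff_right (by norm_num)).mp hlt
  obtain ⟨r, rfl⟩ : ∃ r, k = r + 2 := ⟨k - 2, by omega⟩
  set q := 3 ^ (r + 1) with hq
  have hyq : y ^ q = 1 := by
    rw [← orderOf_dvd_iff_pow_eq_one, hj]
    exact pow_dvd_pow 3 (by omega)
  have hzo : orderOf (x ^ q) = 3 := by
    rw [orderOf_pow_of_dvd (by positivity) (by rw [hk]; exact pow_dvd_pow 3 (by omega)), hk,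
      pow_succ 3 (r + 1)]
    exact Nat.mul_div_cancel_left 3 (by positivity)
  set z := x ^ q with hz
  have hzq : z ^ q = 1 := by
    rw [← orderOf_dvd_iff_pow_eq_one, hzo, hq]
    exact dvd_pow_self 3 (by omega)
  have hz1 : z.1 = 1 := by
    have hs : x.1 ^ 3 = 1 := by
      simpa using pow_card_eq_one' (x := x.1)
    change x.1 ^ q = 1
    rw [hq, pow_succ', pow_mul, hs, one_pow]
  have hz2 : orderOf z.2 = 3 := by
    have h := hzo
    rw [Prod.orderOf, hz1, orderOf_one, Nat.lcm_one_left] at h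
    exact h
  have hcz : c₁ ∈ Subgroup.zpowers z.2 := mem_zpowers_of_cyclic (hc₁.trans hz2.symm)
  have hcard : (Nat.card (Dgrp n)).Coprime (q + 1) := by
    have : Nat.card (Dgrp n) = 3 ^ (n + 1) := by
      simp [pow_succ']
    rw [this]
    apply Nat.Coprime.pow_left
    rw [hq, pow_succ', Nat.coprime_mul_left_add_right]
    norm_num
  have hxz : ∀ i : ℕ, x * z ^ i ∈ T := by
    intro i
    induction i with
    | zero => simpa using hx
    | succ i ih =>
      have := basic_pow hS hT (Nat.succ_ne_zero q) hcard hy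
        (by rw [pow_succ, hyq, one_mul]) ih
      have he : (x * z ^ i) ^ (q + 1) = x * z ^ (i + 1) := by
        rw [pow_succ, mul_pow, ← hz, ← pow_mul, mul_comm i q, pow_mul, hzq, one_pow, mul_one,
          mul_left_comm, pow_succ']
      rwa [he] at this
  have hxH : ∀ h ∈ Subgroup.zpowers ((1, c₁) : Dgrp n), x * h ∈ T := by
    have hle : Subgroup.zpowers ((1, c₁) : Dgrp n) ≤ Subgroup.zpowers z := by
      rw [Subgroup.zpowers_le]
      obtain ⟨i, hi⟩ := Subgroup.mem_zpowers_iff.mp hcz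
      refine Subgroup.mem_zpowers_iff.mpr ⟨i, Prod.ext ?_ hi⟩
      change z.1 ^ i = 1
      rw [hz1, one_zpow]
    intro h hh
    obtain ⟨i, rfl⟩ := mem_powers_iff_mem_zpowers.mpr (hle hh)
    exact hxz i
  refine Finset.eq_of_subset_of_card_le ?_ ?_
  · intro g hg
    obtain ⟨t, ht, rfl⟩ := Finset.mem_image.mp hg
    change (1, c₁) * t ∈ T
    rw [mul_comm]
    exact coset_all hS hT hC1 hx hxH ht _ (Subgroup.mem_zpowers _)
  · rw [Finset.card_image_of_injective _ (mul_right_injective _)]
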